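/- Let a, b > 0, let K = B₂ⁿ / vol_n(B₂ⁿ)^{1/n}, L = (1/2) B_∞ⁿ, and M_n = co[(K, −a), (L, b)] ⊆ ℝ^{n+1}. Set s₀ = (1 − √e)/(b + a√e) and s₁ = (2 − √(πe))/(a√(πe) + 2b). Then for every γ > 0 there is n₀ such that for all n ≥ n₀: (i) ∫_{−1/a}^{1/b} vol_n(M_n^∘(s)) ds ≤ (1 + γ) ∫_{s₀−γ}^{s₁+γ} vol_n(M_n^∘(s)) ds; and (ii) ∫_{−1/a}^{s₀−γ} |s| · vol_n(M_n^∘(s)) ds ≤ γ ∫_{−1/a}^{1/b} vol_n(M_n^∘(s)) ds and ∫_{s₁+γ}^{1/b} |s| · vol_n(M_n^∘(s)) ds ≤ γ ∫_{−1/a}^{1/b} vol_n(M_n^∘(s)) ds. -/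

import Mathlib

open MeasureTheory
open scoped Pointwise RealInnerProductSpace

/-- The polar body of a subset of `ℝⁿ × ℝ = ℝ^{n+1}` (with respect to `0`). -/
def polarProd {n : ℕ} (M : Set (EuclideanSpace ℝ (Fin n) × ℝ)) :
    Set (EuclideanSpace ℝ (Fin n) × ℝ) :=
  {y | ∀ z ∈ M, ⟪y.1, z.1⟫ + y.2 * z.2 ≤ 1}

/-- `K = B₂ⁿ / vol_n(B₂ⁿ)^{1/n}`, the Euclidean ball normalized to volume `1`. -/
noncomputable def normBall (n : ℕ) : Set (EuclideanSpace ℝ (Fin n)) :=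
  ((volume (Metric.closedBall (0 : EuclideanSpace ℝ (Fin n)) 1)).toReal ^ (1 / (n : ℝ)))⁻¹ •
    Metric.closedBall (0 : EuclideanSpace ℝ (Fin n)) 1

/-- `L = (1/2) B_∞ⁿ`, the cube of volume `1`. -/
noncomputable def normCube (n : ℕ) : Set (EuclideanSpace ℝ (Fin n)) :=
  (1 / 2 : ℝ) • {x : EuclideanSpace ℝ (Fin n) | ∀ i, |x i| ≤ 1}

/-- `M_n = co[(K, -a), (L, b)] ⊆ ℝ^{n+1}`. -/
noncomputable def Mbody (a b : ℝ) (n : ℕ) : Set (EuclideanSpace ℝ (Fin n) × ℝ) :=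
  convexHull ℝ ((normBall n ×ˢ ({-a} : Set ℝ)) ∪ (normCube n ×ˢ ({b} : Set ℝ)))

/-- The section `M_n^∘(s) = {z : (z, s) ∈ M_n^∘}` of the polar body of `M_n`. -/
noncomputable def polarSection (a b : ℝ) (n : ℕ) (s : ℝ) :
    Set (EuclideanSpace ℝ (Fin n)) :=
  {z | (z, s) ∈ polarProd (Mbody a b n)}

/-- The cross-polytope `B₁ⁿ = {x : ∑|xᵢ| ≤ 1}`. -/
def B1 (n : ℕ) : Set (EuclideanSpace ℝ (Fin n)) :=
  {x | ∑ i, |x i| ≤ 1}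



lemma lint_smul {n : ℕ} (F : (Fin n → ℝ) → ENNReal) (hF : Measurable F) {r : ℝ} (hr : 0 < r) :
    ∫⁻ x, F x = ENNReal.ofReal (r ^ n) * ∫⁻ x, F (r • x) := by
  have h1 : ∫⁻ x, F (r • x) = ∫⁻ y, F y ∂(Measure.map (fun x : Fin n → ℝ => r • x) volume) := by
    rw [lintegral_map hF (by fun_prop)]
  rw [h1, Measure.map_addHaar_smul _ hr.ne', lintegral_smul_measure, smul_eq_mul, ← mul_assoc,
    ← ENNReal.ofReal_mul (by positivity)]
  simp only [Module.finrank_fintype_fun_eq_card, Fintype.card_fin]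
  rw [abs_of_pos (by positivity), mul_inv_cancel₀ (by positivity)]
  simp

lemma lint_exp (g : ℝ) (hg : 0 ≤ g) :
    ∫⁻ t in Set.Ioi (0:ℝ), (if g ≤ t then ENNReal.ofReal (Real.exp (-t)) else 0)
      = ENNReal.ofReal (Real.exp (-g)) := by
  have h1 : ∫⁻ t in Set.Ioi (0:ℝ), (if g ≤ t then ENNReal.ofReal (Real.exp (-t)) else 0)
      = ∫⁻ t in Set.Ioi g, ENNReal.ofReal (Real.exp (-t)) := by
    rw [← lintegral_indicator measurableSet_Ioi, ← lintegral_indicator measurableSet_Ioi]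
    apply lintegral_congr_ae
    have h2 : ∀ᵐ t : ℝ, t ≠ g := by simp [ae_iff]
    filter_upwards [h2] with t ht
    by_cases h : g < t
    · have : 0 < t := lt_of_le_of_lt hg h
      simp [Set.indicator, h, this, h.le]
    · have : ¬ g ≤ t := fun h' => h (lt_of_le_of_ne h' ht.symm)
      simp [Set.indicator, h, this]
  rw [h1, ← ofReal_integral_eq_lintegral_ofReal, integral_exp_neg_Ioi]
  · exact integrableOn_exp_neg_Ioi g
  · exact Filter.Eventually.of_forall fun t => (Real.exp_pos _).le

lemma lint_gamma (m : ℝ) (hm : 0 ≤ m) :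
    ∫⁻ t in Set.Ioi (0:ℝ), ENNReal.ofReal (Real.exp (-t)) * ENNReal.ofReal (t ^ m)
      = ENNReal.ofReal (Real.Gamma (m + 1)) := by
  rw [Real.Gamma_eq_integral (by linarith), ofReal_integral_eq_lintegral_ofReal]
  · apply setLIntegral_congr_fun measurableSet_Ioi
    intro t ht
    simp only [add_sub_cancel_right]
    rw [ENNReal.ofReal_mul (Real.exp_pos _).le]
  · exact Real.GammaIntegral_convergent (by linarith)
  · refine (ae_restrict_iff' measurableSet_Ioi).2 (Filter.Eventually.of_forall fun t ht => ?_)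
    have : (0:ℝ) < t := ht
    simp only [Pi.zero_apply]
    positivity

lemma lint_layer {n : ℕ} {p q : ℝ} (hp : 0 < p) (hq : 0 ≤ q)
    (G : (Fin n → ℝ) → ℝ) (hG : Measurable G) (hG0 : ∀ x, 0 ≤ G x)
    (hGs : ∀ r > 0, ∀ x, G (r • x) = r ^ p * G x)
    (H : (Fin n → ℝ) → ENNReal) (hH : Measurable H)
    (hHs : ∀ r > 0, ∀ x, H (r • x) = ENNReal.ofReal (r ^ q) * H x) :
    ∫⁻ x, H x * ENNReal.ofReal (Real.exp (-G x)) =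
      ENNReal.ofReal (Real.Gamma ((n + q) / p + 1)) * ∫⁻ x in {x | G x ≤ 1}, H x := by
  have key : ∀ t > (0:ℝ), ∫⁻ x, (if G x ≤ t then H x else 0)
      = ENNReal.ofReal (t ^ ((n + q) / p)) * ∫⁻ x in {x | G x ≤ 1}, H x := by
    intro t ht
    have hr : 0 < t ^ (1 / p) := Real.rpow_pos_of_pos ht _
    have hrp : (t ^ (1 / p)) ^ p = t := by
      rw [← Real.rpow_mul ht.le]; field_simp; simp
    rw [lint_smul _ (Measurable.ite (measurableSet_le hG measurable_const) hH measurable_const) hr]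
    have h3 : ∀ x, (if G (t ^ (1 / p) • x) ≤ t then H (t ^ (1 / p) • x) else 0)
        = ENNReal.ofReal ((t ^ (1/p)) ^ q) * (Set.indicator {x | G x ≤ 1} H x) := by
      intro x
      rw [hGs _ hr, hHs _ hr, hrp]
      by_cases h : G x ≤ 1
      · have : t * G x ≤ t := by nlinarith
        simp [h, this, Set.indicator]
      · have : ¬ t * G x ≤ t := by push Not at h ⊢; nlinarith
        simp [h, this, Set.indicator]
    simp_rw [h3]
    rw [lintegral_const_mul _ (hH.indicator (measurableSet_le hG measurable_const)),
      lintegral_indicator (measurableSet_le hG measurable_const), ← mul_assoc,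
      ← ENNReal.ofReal_mul (by positivity)]
    congr 2
    rw [← Real.rpow_natCast, ← Real.rpow_add hr, ← Real.rpow_mul ht.le]
    congr 1; ring
  calc ∫⁻ x, H x * ENNReal.ofReal (Real.exp (-G x))
      = ∫⁻ x, ∫⁻ t in Set.Ioi (0:ℝ), H x * (if G x ≤ t then ENNReal.ofReal (Real.exp (-t)) else 0) := by
        congr 1; ext x
        rw [lintegral_const_mul, lint_exp _ (hG0 x)]
        exact Measurable.ite (measurableSet_le measurable_const measurable_id) (by fun_prop) measurable_const
    _ = ∫⁻ t in Set.Ioi (0:ℝ), ∫⁻ x, H x * (if G x ≤ t then ENNReal.ofReal (Real.exp (-t)) else 0) := by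
        apply lintegral_lintegral_swap
        apply Measurable.aemeasurable
        apply Measurable.mul (by fun_prop)
        exact Measurable.ite (measurableSet_le (by fun_prop) (by fun_prop)) (by fun_prop) measurable_const
    _ = ∫⁻ t in Set.Ioi (0:ℝ), (ENNReal.ofReal (Real.exp (-t)) * ENNReal.ofReal (t ^ ((n + q) / p)))
          * ∫⁻ x in {x | G x ≤ 1}, H x := by
        apply setLIntegral_congr_fun measurableSet_Ioi
        intro t ht
        simp only
        rw [mul_assoc, ← key t ht, ← lintegral_const_mul]
        · congr 1; ext x; split_ifs <;> simp [mul_comm]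
        · exact Measurable.ite (measurableSet_le hG measurable_const) hH measurable_const
    _ = _ := by
        rw [lintegral_mul_const _ (by fun_prop), lint_gamma _ (by positivity)]

lemma oneD {p q : ℝ} (hp : 0 < p) (hq : 0 ≤ q) :
    Integrable (fun x : ℝ => |x| ^ q * Real.exp (-|x| ^ p)) ∧
    ∫ x : ℝ, |x| ^ q * Real.exp (-|x| ^ p) = 2 / p * Real.Gamma ((q + 1) / p) := by
  have h2 : ∫ x : ℝ, |x| ^ q * Real.exp (-|x| ^ p) = 2 / p * Real.Gamma ((q + 1) / p) := by
    rw [integral_comp_abs (f := fun x => x ^ q * Real.exp (-x ^ p)),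
      integral_rpow_mul_exp_neg_rpow hp (by linarith)]
    ring
  refine ⟨?_, h2⟩
  by_contra h
  rw [integral_undef h] at h2
  have : 0 < Real.Gamma ((q + 1) / p) := Real.Gamma_pos_of_pos (by positivity)
  have : 0 < 2 / p * Real.Gamma ((q + 1) / p) := by positivity
  linarith

lemma nD {n : ℕ} {p q : ℝ} (hp : 0 < p) (hq : 0 ≤ q) (i : Fin n) :
    ∫⁻ x : Fin n → ℝ, ENNReal.ofReal (|x i| ^ q) * ENNReal.ofReal (Real.exp (-∑ j, |x j| ^ p)) =
      ENNReal.ofReal ((2 / p * Real.Gamma ((q + 1) / p)) * (2 / p * Real.Gamma (1 / p)) ^ (n - 1)) := by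
  set f : Fin n → ℝ → ℝ := fun j x => |x| ^ (if j = i then q else 0) * Real.exp (-|x| ^ p) with hf
  have hq' : ∀ j, 0 ≤ (if j = i then q else 0) := fun j => by split_ifs <;> simp [hq]
  have h1 : ∀ x : Fin n → ℝ, ENNReal.ofReal (|x i| ^ q) * ENNReal.ofReal (Real.exp (-∑ j, |x j| ^ p))
     = ENNReal.ofReal (∏ j, f j (x j)) := by
    intro x
    rw [← ENNReal.ofReal_mul (by positivity)]
    simp only [hf, Finset.prod_mul_distrib, ← Real.exp_sum, Finset.sum_neg_distrib]
    congr 2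
    rw [Finset.prod_eq_single i] <;> simp +contextual
  simp_rw [h1]
  rw [← ofReal_integral_eq_lintegral_ofReal, integral_fintype_prod_volume_eq_prod]
  · congr 1
    simp only [hf]
    simp_rw [fun j => (oneD hp (hq' j)).2]
    rw [← Finset.mul_prod_erase _ _ (Finset.mem_univ i)]
    simp only [if_true]
    congr 1
    rw [Finset.prod_congr rfl (g := fun _ => 2 / p * Real.Gamma (1 / p))]
    · simp
    · intro j hj
      simp [Finset.ne_of_mem_erase hj]
  · exact Integrable.fintype_prod (fun j => (oneD hp (hq' j)).1)
  · refine Filter.Eventually.of_forall fun x => Finset.prod_nonneg fun j _ => ?_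
    simp only [hf]; positivity


lemma Ssmul {n : ℕ} (p : ℝ) {r : ℝ} (hr : 0 < r) (x : Fin n → ℝ) :
    ∑ i, |(r • x) i| ^ p = r ^ p * ∑ i, |x i| ^ p := by
  rw [Finset.mul_sum]
  congr 1; ext i
  rw [Pi.smul_apply, smul_eq_mul, abs_mul, abs_of_pos hr, Real.mul_rpow hr.le (abs_nonneg _)]

lemma Smeas {n : ℕ} (p : ℝ) : Measurable (fun x : Fin n → ℝ => ∑ i, |x i| ^ p) := by
  fun_prop

lemma volS {n : ℕ} (hn : 0 < n) {p : ℝ} (hp : 0 < p) :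
    volume {x : Fin n → ℝ | ∑ i, |x i| ^ p ≤ 1} =
      ENNReal.ofReal ((2 / p * Real.Gamma (1 / p)) ^ n / Real.Gamma (n / p + 1)) := by
  have hG : 0 < Real.Gamma (n / p + 1) := Real.Gamma_pos_of_pos (by positivity)
  have h := lint_layer (n := n) hp le_rfl (fun x => ∑ i, |x i| ^ p) (Smeas p)
    (fun x => by positivity) (fun r hr x => Ssmul p hr x) (fun _ => 1) measurable_const
    (by intro r hr x; simp)
  have h2 := nD (n := n) hp le_rfl ⟨0, hn⟩
  simp only [Real.rpow_zero, ENNReal.ofReal_one] at h2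
  rw [h2, setLIntegral_one, zero_add, add_zero, ← pow_succ', Nat.sub_add_cancel hn] at h
  rw [ENNReal.ofReal_div_of_pos hG, ENNReal.eq_div_iff, h]
  · simpa using hG
  · simp

lemma momS {n : ℕ} (hn : 0 < n) {p q : ℝ} (hp : 0 < p) (hq : 0 ≤ q) :
    ∫⁻ x in {x : Fin n → ℝ | ∑ i, |x i| ^ p ≤ 1}, ENNReal.ofReal (∑ i, |x i| ^ q) =
      ENNReal.ofReal (n * Real.Gamma ((q + 1) / p) / Real.Gamma (1 / p) *
        (Real.Gamma (n / p + 1) / Real.Gamma ((n + q) / p + 1))) *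
      volume {x : Fin n → ℝ | ∑ i, |x i| ^ p ≤ 1} := by
  have hG : 0 < Real.Gamma (n / p + 1) := Real.Gamma_pos_of_pos (by positivity)
  have hG1 : 0 < Real.Gamma ((n + q) / p + 1) := Real.Gamma_pos_of_pos (by positivity)
  have hG2 : 0 < Real.Gamma (1 / p) := Real.Gamma_pos_of_pos (by positivity)
  have hG3 : 0 < Real.Gamma ((q + 1) / p) := Real.Gamma_pos_of_pos (by positivity)
  have h := lint_layer (n := n) hp hq (fun x => ∑ i, |x i| ^ p) (Smeas p)
    (fun x => by positivity) (fun r hr x => Ssmul p hr x)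
    (fun x => ENNReal.ofReal (∑ i, |x i| ^ q)) (Smeas q).ennreal_ofReal
    (by intro r hr x; rw [Ssmul q hr x, ENNReal.ofReal_mul (by positivity)])
  have h2 : ∫⁻ x : Fin n → ℝ, ENNReal.ofReal (∑ i, |x i| ^ q) *
      ENNReal.ofReal (Real.exp (-∑ j, |x j| ^ p)) = ENNReal.ofReal (n *
      ((2 / p * Real.Gamma ((q + 1) / p)) * (2 / p * Real.Gamma (1 / p)) ^ (n - 1))) := by
    simp_rw [ENNReal.ofReal_sum_of_nonneg (fun i _ => Real.rpow_nonneg (abs_nonneg _) q),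
      Finset.sum_mul]
    rw [lintegral_finsetSum _ (by intro i _; fun_prop)]
    simp_rw [nD hp hq]
    rw [Finset.sum_const, ENNReal.ofReal_mul (by positivity : (0:ℝ) ≤ n), nsmul_eq_mul]
    simp
  rw [h2] at h
  rw [volS hn hp, ← ENNReal.ofReal_mul (by positivity)]
  have hG1' : ENNReal.ofReal (Real.Gamma ((n + q) / p + 1)) ≠ 0 := by simpa using hG1
  have h3 := (ENNReal.eq_div_iff hG1' ENNReal.ofReal_ne_top).2 h.symm
  rw [h3, ← ENNReal.ofReal_div_of_pos hG1]
  congr 1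
  obtain ⟨k, rfl⟩ : ∃ k, n = k + 1 := ⟨n - 1, by omega⟩
  simp only [Nat.add_sub_cancel, pow_succ]
  field_simp

lemma markovS {n : ℕ} (hn : 0 < n) {p q : ℝ} (hp : 0 < p) (hq : 0 ≤ q) {D T : ℝ} (hD : 0 < D)
    (hT : D * (n * Real.Gamma ((q + 1) / p) / Real.Gamma (1 / p) *
        (Real.Gamma (n / p + 1) / Real.Gamma ((n + q) / p + 1))) ≤ T) :
    (1 - 1 / D) * (volume {x : Fin n → ℝ | ∑ i, |x i| ^ p ≤ 1}).toReal ≤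
      (volume {x : Fin n → ℝ | ∑ i, |x i| ^ p ≤ 1 ∧ ∑ i, |x i| ^ q ≤ T}).toReal := by
  have hG : 0 < Real.Gamma (n / p + 1) := Real.Gamma_pos_of_pos (by positivity)
  have hG1 : 0 < Real.Gamma ((n + q) / p + 1) := Real.Gamma_pos_of_pos (by positivity)
  have hG2 : 0 < Real.Gamma (1 / p) := Real.Gamma_pos_of_pos (by positivity)
  have hG3 : 0 < Real.Gamma ((q + 1) / p) := Real.Gamma_pos_of_pos (by positivity)
  set m := n * Real.Gamma ((q + 1) / p) / Real.Gamma (1 / p) *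
        (Real.Gamma (n / p + 1) / Real.Gamma ((n + q) / p + 1)) with hm
  have hm0 : 0 < m := by positivity
  have hT0 : 0 < T := lt_of_lt_of_le (by positivity) hT
  set A := {x : Fin n → ℝ | ∑ i, |x i| ^ p ≤ 1} with hA
  have hAm : MeasurableSet A := measurableSet_le (Smeas p) measurable_const
  have hAfin : volume A ≠ ⊤ := by rw [hA, volS hn hp]; simp
  set B := {x : Fin n → ℝ | T ≤ ∑ i, |x i| ^ q} with hB
  have hBm : MeasurableSet B := measurableSet_le measurable_const (Smeas q)
  have h1 := mul_meas_ge_le_lintegral (μ := volume.restrict A)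
    (Smeas (n := n) q).ennreal_ofReal (ENNReal.ofReal T)
  rw [momS hn hp hq, ← hm, ← hA] at h1
  have h2 : {x : Fin n → ℝ | ENNReal.ofReal T ≤ ENNReal.ofReal (∑ i, |x i| ^ q)} = B := by
    ext x
    simp only [hB, Set.mem_ofPred_eq]
    rw [ENNReal.ofReal_le_ofReal_iff (by positivity)]
  rw [h2, Measure.restrict_apply hBm] at h1
  have hBAfin : volume (B ∩ A) ≠ ⊤ := measure_ne_top_of_subset Set.inter_subset_right hAfin
  have h3 : T * (volume (B ∩ A)).toReal ≤ m * (volume A).toReal := by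
    have := ENNReal.toReal_mono (by finiteness) h1
    rwa [ENNReal.toReal_mul, ENNReal.toReal_mul, ENNReal.toReal_ofReal hT0.le,
      ENNReal.toReal_ofReal hm0.le] at this
  set C := {x : Fin n → ℝ | ∑ i, |x i| ^ p ≤ 1 ∧ ∑ i, |x i| ^ q ≤ T} with hC
  have hCfin : volume C ≠ ⊤ := measure_ne_top_of_subset (fun x hx => hx.1) hAfin
  have h4 : volume A ≤ volume C + volume (B ∩ A) := by
    refine le_trans (measure_mono ?_) (measure_union_le _ _)
    intro x hx
    by_cases h : ∑ i, |x i| ^ q ≤ T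
    · exact Or.inl ⟨hx, h⟩
    · exact Or.inr ⟨(not_le.1 h).le, hx⟩
  have h5 : (volume A).toReal ≤ (volume C).toReal + (volume (B ∩ A)).toReal := by
    rw [← ENNReal.toReal_add hCfin hBAfin]
    exact ENNReal.toReal_mono (by finiteness) h4
  have h6 : D * m * (volume (B ∩ A)).toReal ≤ m * (volume A).toReal :=
    le_trans (mul_le_mul_of_nonneg_right hT ENNReal.toReal_nonneg) h3
  have h7 : D * (volume (B ∩ A)).toReal ≤ (volume A).toReal := by
    have : m * (D * (volume (B ∩ A)).toReal) ≤ m * (volume A).toReal := by linarith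
    exact le_of_mul_le_mul_left this hm0
  have h8 : (volume (B ∩ A)).toReal ≤ (volume A).toReal / D := by
    rw [le_div_iff₀ hD]; linarith
  have : (1 - 1 / D) * (volume A).toReal = (volume A).toReal - (volume A).toReal / D := by ring
  linarith

/-- Real volume of the `ℓ_p` unit ball. -/
noncomputable def volB (p : ℝ) (n : ℕ) : ℝ :=
  (volume {x : Fin n → ℝ | ∑ i, |x i| ^ p ≤ 1}).toReal

lemma scaleS {n : ℕ} {p q : ℝ} {r : ℝ} (hr : 0 < r) (T : ℝ) :
    (volume {x : Fin n → ℝ | ∑ i, |x i| ^ p ≤ r ^ p ∧ ∑ i, |x i| ^ q ≤ r ^ q * T}).toReal =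
      r ^ n * (volume {x : Fin n → ℝ | ∑ i, |x i| ^ p ≤ 1 ∧ ∑ i, |x i| ^ q ≤ T}).toReal := by
  have : {x : Fin n → ℝ | ∑ i, |x i| ^ p ≤ r ^ p ∧ ∑ i, |x i| ^ q ≤ r ^ q * T} =
      r • {x : Fin n → ℝ | ∑ i, |x i| ^ p ≤ 1 ∧ ∑ i, |x i| ^ q ≤ T} := by
    ext x
    rw [Set.mem_smul_set]
    constructor
    · rintro ⟨h1, h2⟩
      refine ⟨r⁻¹ • x, ?_, by rw [smul_inv_smul₀ hr.ne']⟩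
      constructor
      · rw [Ssmul p (by positivity), Real.inv_rpow hr.le, inv_mul_le_iff₀ (by positivity)]
        simpa using h1
      · rw [Ssmul q (by positivity), Real.inv_rpow hr.le, inv_mul_le_iff₀ (by positivity)]
        exact h2
    · rintro ⟨y, ⟨h1, h2⟩, rfl⟩
      refine ⟨?_, ?_⟩
      · rw [Ssmul p hr]
        nlinarith [Real.rpow_pos_of_pos hr p]
      · rw [Ssmul q hr]
        exact mul_le_mul_of_nonneg_left h2 (by positivity)
  rw [this, Measure.addHaar_smul, ENNReal.toReal_mul]
  simp only [Module.finrank_fintype_fun_eq_card, Fintype.card_fin]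
  rw [abs_of_pos (by positivity), ENNReal.toReal_ofReal (by positivity)]

lemma upperS {n : ℕ} (hn : 0 < n) {p q : ℝ} (hp : 0 < p) {r : ℝ} (hr : 0 < r) (T : ℝ) :
    (volume {x : Fin n → ℝ | ∑ i, |x i| ^ p ≤ r ^ p ∧ ∑ i, |x i| ^ q ≤ T}).toReal ≤
      r ^ n * volB p n := by
  have h : T = r ^ q * (T / r ^ q) := by
    have : 0 < r ^ q := by positivity
    field_simp
  rw [h, scaleS hr]
  refine mul_le_mul_of_nonneg_left ?_ (by positivity)
  apply ENNReal.toReal_mono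
  · rw [volS hn hp]; simp
  · exact measure_mono fun x hx => hx.1

lemma lowerS {n : ℕ} (hn : 0 < n) {p q : ℝ} (hp : 0 < p) (hq : 0 ≤ q) {r : ℝ} (hr : 0 < r)
    {D T : ℝ} (hD : 0 < D)
    (hT : r ^ q * (D * (n * Real.Gamma ((q + 1) / p) / Real.Gamma (1 / p) *
        (Real.Gamma (n / p + 1) / Real.Gamma ((n + q) / p + 1)))) ≤ T) :
    (1 - 1 / D) * (r ^ n * volB p n) ≤
    (volume {x : Fin n → ℝ | ∑ i, |x i| ^ p ≤ r ^ p ∧ ∑ i, |x i| ^ q ≤ T}).toReal := by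
  have hrq : 0 < r ^ q := by positivity
  have h : T = r ^ q * (T / r ^ q) := by field_simp
  have h1 := markovS hn hp hq hD (T := T / r ^ q) (by rw [le_div_iff₀ hrq]; linarith)
  rw [h, scaleS hr]
  have := mul_le_mul_of_nonneg_left h1 (by positivity : 0 ≤ r ^ n)
  unfold volB
  linarith

lemma momEst1 {n : ℕ} (hn : 0 < n) :
    (n * Real.Gamma (((1:ℝ) + 1) / 2) / Real.Gamma (1 / 2) *
        (Real.Gamma ((n:ℝ) / 2 + 1) / Real.Gamma (((n:ℝ) + 1) / 2 + 1))) ≤ √(2 * n / Real.pi) := by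
  have hn' : (0:ℝ) < n := by exact_mod_cast hn
  have hG : 0 < Real.Gamma ((n:ℝ) / 2 + 1) := Real.Gamma_pos_of_pos (by positivity)
  have hG1 : 0 < Real.Gamma (((n:ℝ) + 1) / 2 + 1) := Real.Gamma_pos_of_pos (by positivity)
  have hG2 : 0 < Real.Gamma (((n:ℝ) + 1) / 2) := Real.Gamma_pos_of_pos (by positivity)
  have h1 := Real.Gamma_mul_add_mul_le_rpow_Gamma_mul_rpow_Gamma (s := ((n:ℝ) + 1) / 2)
    (t := ((n:ℝ) + 1) / 2 + 1) (a := 1/2) (b := 1/2) (by positivity) (by positivity)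
    (by norm_num) (by norm_num) (by norm_num)
  rw [show (1 / 2 : ℝ) * (((n:ℝ) + 1) / 2) + 1 / 2 * (((n:ℝ) + 1) / 2 + 1) = (n:ℝ) / 2 + 1 by ring,
    ← Real.mul_rpow hG2.le hG1.le, ← Real.sqrt_eq_rpow] at h1
  have h2 : Real.Gamma (((n:ℝ) + 1) / 2 + 1) = ((n:ℝ) + 1) / 2 * Real.Gamma (((n:ℝ) + 1) / 2) :=
    Real.Gamma_add_one (by positivity)
  have h3 : Real.Gamma ((n:ℝ) / 2 + 1) ^ 2 ≤
      Real.Gamma (((n:ℝ) + 1) / 2) * Real.Gamma (((n:ℝ) + 1) / 2 + 1) := by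
    have := pow_le_pow_left₀ hG.le h1 2
    rwa [Real.sq_sqrt (by positivity)] at this
  rw [show ((1:ℝ) + 1) / 2 = 1 by norm_num, Real.Gamma_one, Real.Gamma_one_half_eq]
  apply Real.le_sqrt_of_sq_le
  have hpi := Real.pi_pos
  rw [mul_pow, div_pow, div_pow, Real.sq_sqrt hpi.le]
  have h4 : Real.Gamma ((n:ℝ) / 2 + 1) ^ 2 / Real.Gamma (((n:ℝ) + 1) / 2 + 1) ^ 2 ≤ 2 / n := by
    rw [div_le_div_iff₀ (by positivity) hn']
    rw [h2] at h3 ⊢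
    have : 0 < Real.Gamma (((n:ℝ) + 1) / 2) ^ 2 := by positivity
    nlinarith [mul_le_mul_of_nonneg_right h3 hn'.le]
  calc _ ≤ ((n:ℝ) * 1) ^ 2 / Real.pi * (2 / n) := by gcongr
    _ = _ := by field_simp

lemma momEst2 {n : ℕ} (hn : 0 < n) :
    (n * Real.Gamma (((2:ℝ) + 1) / 1) / Real.Gamma (1 / 1) *
        (Real.Gamma ((n:ℝ) / 1 + 1) / Real.Gamma (((n:ℝ) + 2) / 1 + 1))) ≤ 2 / n := by
  have hn' : (0:ℝ) < n := by exact_mod_cast hn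
  have hG : 0 < Real.Gamma ((n:ℝ) + 1) := Real.Gamma_pos_of_pos (by positivity)
  simp only [div_one, Real.Gamma_one]
  have h3 : Real.Gamma ((2:ℝ) + 1) = 2 := by
    rw [Real.Gamma_add_one (by norm_num), Real.Gamma_two]; norm_num
  have h1 : Real.Gamma ((n:ℝ) + 2 + 1) = (n + 2) * ((n + 1) * Real.Gamma ((n:ℝ) + 1)) := by
    rw [Real.Gamma_add_one (by positivity), show (n:ℝ) + 2 = (n + 1) + 1 by ring,
      Real.Gamma_add_one (by positivity)]
  rw [h1, h3]
  rw [mul_div_assoc', div_le_div_iff₀ (by positivity) hn']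
  have : 0 < Real.Gamma ((n:ℝ) + 1) * n := by positivity
  nlinarith

lemma gamma_lower {x : ℝ} (hx : 0 < x) : (x / Real.exp 1) ^ x ≤ Real.Gamma (x + 1) := by
  have hE : (x / Real.exp 1) ^ x = x ^ x * Real.exp (-x) := by
    rw [Real.div_rpow hx.le (Real.exp_pos _).le, ← Real.exp_mul, Real.exp_neg, one_mul]; rfl
  have hIntg : IntegrableOn (fun t : ℝ => Real.exp (-t) * t ^ (x + 1 - 1)) (Set.Ioi 0) :=
    Real.GammaIntegral_convergent (by linarith)
  rw [hE, Real.Gamma_eq_integral (by linarith), ← integral_exp_neg_Ioi, ← integral_const_mul]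
  calc ∫ t in Set.Ioi x, x ^ x * Real.exp (-t)
      ≤ ∫ t in Set.Ioi x, Real.exp (-t) * t ^ (x + 1 - 1) := by
        apply setIntegral_mono_on ((integrableOn_exp_neg_Ioi x).const_mul _)
          (hIntg.mono_set (Set.Ioi_subset_Ioi hx.le)) measurableSet_Ioi
        intro t ht
        have ht' : x < t := ht
        rw [add_sub_cancel_right, mul_comm]
        gcongr
    _ ≤ _ := by
        apply setIntegral_mono_set hIntg
        · refine (ae_restrict_iff' measurableSet_Ioi).2 (Filter.Eventually.of_forall fun t ht => ?_)
          have : (0:ℝ) < t := ht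
          simp only [Pi.zero_apply]
          positivity
        · exact (Set.Ioi_subset_Ioi hx.le).eventuallyLE

lemma gamma_upper {x l : ℝ} (hx : 0 < x) (hl : 0 < l) (hl1 : l < 1) :
    Real.Gamma (x + 1) ≤ (x / (l * Real.exp 1)) ^ x / (1 - l) := by
  have hIntg : IntegrableOn (fun t : ℝ => Real.exp (-t) * t ^ (x + 1 - 1)) (Set.Ioi 0) :=
    Real.GammaIntegral_convergent (by linarith)
  have hI : ∫ t in Set.Ioi (0:ℝ), Real.exp (-(1 - l) * t) = 1 / (1 - l) := by
    rw [integral_exp_mul_Ioi (by linarith) 0]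
    simp only [mul_zero, Real.exp_zero]
    rw [neg_div_neg_eq]
  have hIntg2 : IntegrableOn (fun t : ℝ => Real.exp (-(1 - l) * t)) (Set.Ioi 0) :=
    integrableOn_exp_mul_Ioi (by linarith) 0
  rw [Real.Gamma_eq_integral (by linarith), div_eq_mul_one_div, ← hI, ← integral_const_mul]
  apply setIntegral_mono_on hIntg (hIntg2.const_mul _) measurableSet_Ioi
  intro t ht
  have ht' : 0 < t := ht
  rw [add_sub_cancel_right]
  have h1 : l * t / x ≤ Real.exp (l * t / x - 1) := by
    have := Real.add_one_le_exp (l * t / x - 1); linarith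
  have h2 : (l * t / x) ^ x ≤ Real.exp (l * t - x) := by
    calc (l * t / x) ^ x ≤ (Real.exp (l * t / x - 1)) ^ x := by gcongr
      _ = Real.exp (l * t - x) := by rw [← Real.exp_mul]; congr 1; field_simp
  have h3 : t ^ x = (x / (l * Real.exp 1)) ^ x * Real.exp x * (l * t / x) ^ x := by
    have : Real.exp x = (Real.exp 1) ^ x := by rw [← Real.exp_mul, one_mul]
    rw [this, ← Real.mul_rpow (by positivity) (by positivity),
      ← Real.mul_rpow (by positivity) (by positivity)]
    congr 1; field_simp
  have h4 : Real.exp (-(1 - l) * t) = Real.exp (-t) * Real.exp x * Real.exp (l * t - x) := by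
    rw [← Real.exp_add, ← Real.exp_add]; congr 1; ring
  rw [h3, h4]
  have h5 : 0 ≤ (x / (l * Real.exp 1)) ^ x := by positivity
  calc _ = (x / (l * Real.exp 1)) ^ x * (Real.exp (-t) * Real.exp x * (l * t / x) ^ x) := by ring
    _ ≤ _ := by gcongr

lemma volB_two {n : ℕ} (hn : 0 < n) : volB 2 n = √Real.pi ^ n / Real.Gamma (n / 2 + 1) := by
  have : 0 < Real.Gamma ((n:ℝ) / 2 + 1) := Real.Gamma_pos_of_pos (by positivity)
  unfold volB
  rw [volS hn (by norm_num), ENNReal.toReal_ofReal]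
  · norm_num [Real.Gamma_one_half_eq]
  · have := Real.Gamma_pos_of_pos (show (0:ℝ) < 1/2 by norm_num)
    positivity

lemma volBall {n : ℕ} (hn : 0 < n) :
    (volume (Metric.closedBall (0 : EuclideanSpace ℝ (Fin n)) 1)).toReal = volB 2 n := by
  have : Nonempty (Fin n) := ⟨⟨0, hn⟩⟩
  have : 0 < Real.Gamma ((n:ℝ) / 2 + 1) := Real.Gamma_pos_of_pos (by positivity)
  rw [EuclideanSpace.volume_closedBall, volB_two hn]
  simp only [ENNReal.ofReal_one, one_pow, one_mul, Fintype.card_fin]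
  rw [ENNReal.toReal_ofReal (by positivity)]

/-- `vol(B₂ⁿ)^{1/n}`. -/
noncomputable def wn (n : ℕ) : ℝ := (volB 2 n) ^ (1 / (n : ℝ))

lemma volB_two_pos {n : ℕ} (hn : 0 < n) : 0 < volB 2 n := by
  have : 0 < Real.Gamma ((n:ℝ) / 2 + 1) := Real.Gamma_pos_of_pos (by positivity)
  have := Real.pi_pos
  rw [volB_two hn]; positivity

lemma wn_pos {n : ℕ} (hn : 0 < n) : 0 < wn n := Real.rpow_pos_of_pos (volB_two_pos hn) _

lemma wn_pow {n : ℕ} (hn : 0 < n) : wn n ^ n = volB 2 n := by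
  unfold wn
  rw [one_div, Real.rpow_inv_natCast_pow (volB_two_pos hn).le hn.ne']

lemma sqrt_pow_aux {n : ℕ} (y : ℝ) (hy : 0 ≤ y) : √y ^ n = y ^ ((n:ℝ) / 2) := by
  rw [Real.sqrt_eq_rpow, ← Real.rpow_natCast, ← Real.rpow_mul hy]; congr 1; ring

lemma wn_upper {n : ℕ} (hn : 0 < n) : wn n ≤ √(2 * Real.pi * Real.exp 1 / n) := by
  have hn' : (0:ℝ) < n := by exact_mod_cast hn
  have hpi := Real.pi_pos
  refine le_of_pow_le_pow_left₀ hn.ne' (Real.sqrt_nonneg _) ?_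
  have hx : (0:ℝ) < n / 2 := by positivity
  rw [wn_pow hn, volB_two hn, sqrt_pow_aux _ hpi.le, sqrt_pow_aux _ (by positivity)]
  have h1 := gamma_lower hx
  have h0 : (0:ℝ) < (n / 2 / Real.exp 1) ^ ((n:ℝ) / 2) := by positivity
  calc _ ≤ Real.pi ^ ((n:ℝ) / 2) / (n / 2 / Real.exp 1) ^ ((n:ℝ) / 2) := by gcongr
    _ = _ := by
      rw [← Real.div_rpow (by positivity) (by positivity)]
      congr 1; field_simp

lemma wn_lower {η : ℝ} (h0 : 0 < η) (h1 : η < 1) :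
    ∃ N : ℕ, ∀ n ≥ N, 0 < n → η * √(2 * Real.pi * Real.exp 1 / n) ≤ wn n := by
  have hs : √η < 1 := by rw [Real.sqrt_lt' one_pos]; simpa using h1
  obtain ⟨N, hN⟩ := exists_pow_lt_of_lt_one (show 0 < 1 - η by linarith) hs
  refine ⟨N, fun n hnN hn => ?_⟩
  have hn' : (0:ℝ) < n := by exact_mod_cast hn
  have hpi := Real.pi_pos
  refine le_of_pow_le_pow_left₀ hn.ne' (wn_pos hn).le ?_
  have hx : (0:ℝ) < n / 2 := by positivity
  have hG : 0 < Real.Gamma ((n:ℝ) / 2 + 1) := Real.Gamma_pos_of_pos (by positivity)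
  rw [wn_pow hn, volB_two hn, mul_pow, sqrt_pow_aux _ hpi.le, sqrt_pow_aux _ (by positivity),
    le_div_iff₀ hG]
  have h2 := gamma_upper hx h0 h1
  have h3 : √η ^ n ≤ 1 - η :=
    (pow_le_pow_of_le_one (Real.sqrt_nonneg _) hs.le hnN).trans hN.le
  have h4 : η ^ n = √η ^ n * η ^ ((n:ℝ)/2) := by
    rw [← sqrt_pow_aux _ h0.le, ← mul_pow, Real.mul_self_sqrt h0.le]
  have h5 : (2 * Real.pi * Real.exp 1 / n) ^ ((n:ℝ) / 2) * (η ^ ((n:ℝ) / 2) *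
      ((n:ℝ) / 2 / (η * Real.exp 1)) ^ ((n:ℝ) / 2)) = Real.pi ^ ((n:ℝ) / 2) := by
    rw [← Real.mul_rpow (by positivity) (by positivity),
      ← Real.mul_rpow (by positivity) (by positivity)]
    congr 1; field_simp
  have h6 : 0 < 1 - η := by linarith
  calc η ^ n * (2 * Real.pi * Real.exp 1 / n) ^ ((n:ℝ) / 2) * Real.Gamma ((n:ℝ) / 2 + 1)
      ≤ ((1 - η) * η ^ ((n:ℝ)/2)) * (2 * Real.pi * Real.exp 1 / n) ^ ((n:ℝ) / 2) *
        (((n:ℝ) / 2 / (η * Real.exp 1)) ^ ((n:ℝ) / 2) / (1 - η)) := by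
        rw [h4]; gcongr
    _ = (2 * Real.pi * Real.exp 1 / n) ^ ((n:ℝ) / 2) * (η ^ ((n:ℝ) / 2) *
      ((n:ℝ) / 2 / (η * Real.exp 1)) ^ ((n:ℝ) / 2)) := by field_simp
    _ = _ := h5

lemma mem_section {n : ℕ} (hn : 0 < n) (a b s : ℝ) (z : EuclideanSpace ℝ (Fin n)) :
    z ∈ polarSection a b n s ↔ ‖z‖ ≤ (1 + s * a) * wn n ∧ ∑ i, |z i| ≤ 2 * (1 - s * b) := by
  have hw := wn_pos hn
  have hK : normBall n = (wn n)⁻¹ • Metric.closedBall (0 : EuclideanSpace ℝ (Fin n)) 1 := by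
    unfold normBall wn; rw [volBall hn]
  have h1 : z ∈ polarSection a b n s ↔
      (∀ k ∈ normBall n, ⟪z, k⟫ + s * (-a) ≤ 1) ∧ (∀ k ∈ normCube n, ⟪z, k⟫ + s * b ≤ 1) := by
    constructor
    · intro h
      constructor
      · intro k hk
        exact h (k, -a) (subset_convexHull ℝ _ (Or.inl ⟨hk, rfl⟩))
      · intro k hk
        exact h (k, b) (subset_convexHull ℝ _ (Or.inr ⟨hk, rfl⟩))
    · rintro ⟨hA, hB⟩
      have hconv : Convex ℝ {y : EuclideanSpace ℝ (Fin n) × ℝ | ⟪z, y.1⟫ + s * y.2 ≤ 1} := by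
        refine convex_halfSpace_le (f := fun y : EuclideanSpace ℝ (Fin n) × ℝ => ⟪z, y.1⟫ + s * y.2) ?_ 1
        constructor
        · intro x y; simp only [Prod.fst_add, Prod.snd_add, inner_add_right]; ring
        · intro c x; simp only [Prod.smul_fst, Prod.smul_snd, real_inner_smul_right, smul_eq_mul]; ring
      intro y hy
      refine convexHull_min ?_ hconv hy
      rintro ⟨k, t⟩ (⟨hk, ht⟩ | ⟨hk, ht⟩)
      · have : t = -a := ht
        subst this
        exact hA k hk
      · have : t = b := ht
        subst this
        exact hB k hk
  rw [h1]
  refine and_congr ?_ ?_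
  · rw [hK]
    constructor
    · intro h
      by_cases hz : z = 0
      · have := h 0 ⟨0, by simp, by simp⟩
        simp only [inner_zero_right] at this
        rw [hz, norm_zero]
        exact mul_nonneg (by linarith) hw.le
      · have hz' : 0 < ‖z‖ := norm_pos_iff.2 hz
        have := h ((wn n)⁻¹ • (‖z‖⁻¹ • z)) ⟨‖z‖⁻¹ • z, by
          simp [norm_smul, hz'.ne'], rfl⟩
        rw [real_inner_smul_right, real_inner_smul_right, real_inner_self_eq_norm_sq] at this
        have h2 : (wn n)⁻¹ * (‖z‖⁻¹ * ‖z‖ ^ 2) = ‖z‖ / wn n := by field_simp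
        rw [h2] at this
        rw [← div_le_iff₀ hw]; linarith
    · rintro h k ⟨u, hu, rfl⟩
      have hu' : ‖u‖ ≤ 1 := by simpa using hu
      simp only [real_inner_smul_right]
      have h2 : ⟪z, u⟫ ≤ ‖z‖ := (real_inner_le_norm _ _).trans (by nlinarith [norm_nonneg z])
      have h3 : (wn n)⁻¹ * ⟪z, u⟫ ≤ 1 + s * a := by
        rw [inv_mul_le_iff₀ hw]; linarith
      linarith
  · constructor
    · intro h
      have := h ((1/2 : ℝ) • (WithLp.toLp 2 (fun i => SignType.sign (z i) : Fin n → ℝ))) ⟨_, by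
        intro i
        rcases lt_trichotomy (z i) 0 with hi | hi | hi <;> simp [hi], rfl⟩
      rw [real_inner_smul_right] at this
      have h2 : ⟪z, (WithLp.toLp 2 (fun i => SignType.sign (z i) : Fin n → ℝ))⟫ = ∑ i, |z i| := by
        simp [PiLp.inner_apply, mul_comm, self_mul_sign]
      rw [h2] at this
      linarith
    · rintro h k ⟨u, hu, rfl⟩
      simp only [real_inner_smul_right]
      have h2 : ⟪z, u⟫ ≤ ∑ i, |z i| := by
        simp only [PiLp.inner_apply]
        apply Finset.sum_le_sum
        intro i _
        calc ⟪z i, u i⟫ ≤ |z i * u i| := by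
              simp only [RCLike.inner_apply, conj_trivial]; rw [mul_comm]; exact le_abs_self _
          _ = |z i| * |u i| := abs_mul _ _
          _ ≤ |z i| := by nlinarith [hu i, abs_nonneg (z i)]
      linarith

lemma volSec {n : ℕ} (hn : 0 < n) (a b s : ℝ) (hs : 0 ≤ 1 + s * a) :
    volume (polarSection a b n s) = volume {x : Fin n → ℝ |
      ∑ i, |x i| ^ (2:ℝ) ≤ ((1 + s * a) * wn n) ^ (2:ℝ) ∧ ∑ i, |x i| ^ (1:ℝ) ≤ 2 * (1 - s * b)} := by
  have hw := wn_pos hn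
  rw [← (PiLp.volume_preserving_ofLp (Fin n)).measure_preimage]
  · congr 1
    ext z
    rw [mem_section hn]
    have h0 : 0 ≤ (1 + s * a) * wn n := mul_nonneg hs hw.le
    have h1 : ‖z‖ ≤ (1 + s * a) * wn n ↔ ∑ i, |z i| ^ (2:ℝ) ≤ ((1 + s * a) * wn n) ^ (2:ℝ) := by
      rw [EuclideanSpace.norm_eq, Real.sqrt_le_left h0]
      simp
    simp only [Set.mem_preimage, Real.rpow_one]
    rw [h1]
    rfl
  · apply MeasurableSet.nullMeasurableSet
    exact (measurableSet_le (Smeas 2) measurable_const).inter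
      (measurableSet_le (Smeas 1) measurable_const)


/-- The volume of the section, as a real function. -/
noncomputable def fsec (a b : ℝ) (n : ℕ) (s : ℝ) : ℝ := (volume (polarSection a b n s)).toReal

lemma fsec_nonneg (a b : ℝ) (n : ℕ) (s : ℝ) : 0 ≤ fsec a b n s := ENNReal.toReal_nonneg

lemma fsec_zero {n : ℕ} (hn : 0 < n) (a b s : ℝ) (h : 1 + s * a ≤ 0 ∨ 1 - s * b ≤ 0) :
    fsec a b n s = 0 := by
  have hw := wn_pos hn
  have : Nonempty (Fin n) := ⟨⟨0, hn⟩⟩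
  have hsub : polarSection a b n s ⊆ {0} := by
    intro z hz
    rw [mem_section hn] at hz
    obtain ⟨h1, h2⟩ := hz
    rw [Set.mem_singleton_iff]
    rcases h with h | h
    · have : ‖z‖ ≤ 0 := h1.trans (mul_nonpos_of_nonpos_of_nonneg h hw.le)
      simpa using this
    · have h3 : ∑ i, |z i| ≤ 0 := h2.trans (by linarith)
      have h4 : ∑ i, |z i| = 0 := le_antisymm h3 (Finset.sum_nonneg fun i _ => abs_nonneg _)
      rw [Finset.sum_eq_zero_iff_of_nonneg (fun i _ => abs_nonneg _)] at h4
      ext i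
      simpa using h4 i (Finset.mem_univ i)
  unfold fsec
  rw [measure_mono_null hsub (measure_singleton _)]
  rfl

lemma volB_nonneg (p : ℝ) (n : ℕ) : 0 ≤ volB p n := ENNReal.toReal_nonneg

lemma fsec_upper1 {n : ℕ} (hn : 0 < n) (a b s : ℝ) (h : 0 ≤ 1 + s * a) :
    fsec a b n s ≤ (1 + s * a) ^ n * (wn n ^ n * volB 2 n) := by
  have hw := wn_pos hn
  rcases h.eq_or_lt with h | h
  · rw [fsec_zero hn a b s (Or.inl h.symm.le)]
    have := volB_nonneg 2 n
    positivity
  · unfold fsec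
    rw [volSec hn a b s h.le, ← mul_assoc, ← mul_pow]
    exact upperS hn (by norm_num) (by positivity) _

lemma volSec' {n : ℕ} (hn : 0 < n) (a b s : ℝ) (hs : 0 ≤ 1 + s * a) :
    volume (polarSection a b n s) = volume {x : Fin n → ℝ |
      ∑ i, |x i| ^ (1:ℝ) ≤ (2 * (1 - s * b)) ^ (1:ℝ) ∧
      ∑ i, |x i| ^ (2:ℝ) ≤ ((1 + s * a) * wn n) ^ (2:ℝ)} := by
  rw [volSec hn a b s hs, Real.rpow_one]
  congr 1
  ext x
  exact and_comm

lemma fsec_upper2 {n : ℕ} (hn : 0 < n) (a b s : ℝ) (h : 0 ≤ 1 - s * b) :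
    fsec a b n s ≤ (1 - s * b) ^ n * (2 ^ n * volB 1 n) := by
  have hV := volB_nonneg 1 n
  rcases h.eq_or_lt with h | h
  · rw [fsec_zero hn a b s (Or.inr h.symm.le)]
    rw [← h]; positivity
  · rcases le_total (1 + s * a) 0 with h' | h'
    · rw [fsec_zero hn a b s (Or.inl h')]
      positivity
    · unfold fsec
      rw [volSec' hn a b s h', ← mul_assoc, ← mul_pow, mul_comm _ (2:ℝ)]
      exact upperS hn (by norm_num) (by positivity) _

lemma fsec_meas (a b : ℝ) (n : ℕ) : Measurable (fsec a b n) := by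
  have hc : IsClosed (polarProd (Mbody a b n)) := by
    unfold polarProd
    simp only [Set.ofPred_forall]
    refine isClosed_iInter fun z => isClosed_iInter fun _ => ?_
    exact isClosed_le (by fun_prop) continuous_const
  have := measurable_measure_prodMk_right (μ := (volume : Measure (EuclideanSpace ℝ (Fin n))))
    hc.measurableSet
  exact this.ennreal_toReal

lemma fsec_int {n : ℕ} (hn : 0 < n) (a b : ℝ) (p q : ℝ) :
    IntervalIntegrable (fsec a b n) volume p q := by
  have hg : IntervalIntegrable (fun s => |1 + s * a| ^ n * (wn n ^ n * volB 2 n)) volume p q :=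
    Continuous.intervalIntegrable (by fun_prop) _ _
  refine hg.mono_fun (fsec_meas a b n).aestronglyMeasurable (Filter.Eventually.of_forall fun s => ?_)
  have hw := wn_pos hn
  have hV := volB_nonneg 2 n
  simp only
  rw [Real.norm_of_nonneg (fsec_nonneg _ _ _ _), Real.norm_of_nonneg (by positivity)]
  rcases le_total (1 + s * a) 0 with h' | h'
  · rw [fsec_zero hn a b s (Or.inl h')]; positivity
  · rw [abs_of_nonneg h']; exact fsec_upper1 hn a b s h'

lemma core (f : ℕ → ℝ → ℝ) (U : ℕ → ℝ) {κ p q p' q' q1 q2 : ℝ} (hU : ∀ n, 0 ≤ U n)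
    (hκ : 0 < κ) (hpq : p ≤ q) (hpq' : p' < q') (h1 : 0 ≤ q1) (h12 : q1 < q2)
    (hIntg : ∀ n, 0 < n → ∀ u v, IntervalIntegrable (f n) volume u v)
    (hup : ∀ n, 0 < n → ∀ s ∈ Set.Icc p q, f n s ≤ q1 ^ n * U n)
    (hlow : ∃ N : ℕ, ∀ n ≥ N, 0 < n → ∀ s ∈ Set.Icc p' q', κ * (q2 ^ n * U n) ≤ f n s)
    {ε : ℝ} (hε : 0 < ε) :
    ∃ N : ℕ, ∀ n ≥ N, 0 < n → ∫ s in p..q, f n s ≤ ε * ∫ s in p'..q', f n s := by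
  obtain ⟨N, hN⟩ := hlow
  have h2 : 0 < q2 := lt_of_le_of_lt h1 h12
  have hr : q1 / q2 < 1 := by rwa [div_lt_one h2]
  have hc : 0 < ε * ((q' - p') * κ) / (q - p + 1) := by
    have : 0 < q' - p' := by linarith
    have : 0 < q - p + 1 := by linarith
    positivity
  obtain ⟨N', hN'⟩ := exists_pow_lt_of_lt_one hc hr
  refine ⟨max N N', fun n hn h0 => ?_⟩
  have hA : ∫ s in p..q, f n s ≤ (q - p) * (q1 ^ n * U n) := by
    have := intervalIntegral.integral_mono_on hpq (hIntg n h0 p q)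
      (intervalIntegrable_const (c := q1 ^ n * U n)) (hup n h0)
    rwa [intervalIntegral.integral_const, smul_eq_mul] at this
  have hB : (q' - p') * (κ * (q2 ^ n * U n)) ≤ ∫ s in p'..q', f n s := by
    have := intervalIntegral.integral_mono_on hpq'.le
      (intervalIntegrable_const (c := κ * (q2 ^ n * U n))) (hIntg n h0 p' q')
      (hN n (le_of_max_le_left hn) h0)
    rwa [intervalIntegral.integral_const, smul_eq_mul] at this
  have hC : (q1 / q2) ^ n ≤ ε * ((q' - p') * κ) / (q - p + 1) :=
    (pow_le_pow_of_le_one (by positivity) hr.le (le_of_max_le_right hn)).trans hN'.le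
  have hq : 0 < q - p + 1 := by linarith
  rw [div_pow, div_le_div_iff₀ (by positivity) hq] at hC
  have hq1 : 0 ≤ q1 ^ n := by positivity
  have hD : (q - p) * q1 ^ n ≤ ε * ((q' - p') * κ) * q2 ^ n := by nlinarith
  calc _ ≤ (q - p) * (q1 ^ n * U n) := hA
    _ = (q - p) * q1 ^ n * U n := by ring
    _ ≤ ε * ((q' - p') * κ) * q2 ^ n * U n := mul_le_mul_of_nonneg_right hD (hU n)
    _ = ε * ((q' - p') * (κ * (q2 ^ n * U n))) := by ring
    _ ≤ _ := by gcongr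

lemma fsec_lower1 {n : ℕ} (hn : 0 < n) {a b s D : ℝ} (hs : 0 < 1 + s * a) (hD : 0 < D)
    (h : D * √(Real.exp 1) * (1 + s * a) ≤ 1 - s * b) :
    (1 - 1 / D) * ((1 + s * a) ^ n * (wn n ^ n * volB 2 n)) ≤ fsec a b n s := by
  have hw := wn_pos hn
  have hpi := Real.pi_pos
  have hn' : (0:ℝ) < n := by exact_mod_cast hn
  unfold fsec
  rw [volSec hn a b s hs.le, ← mul_assoc ((1 + s * a) ^ n), ← mul_pow]
  refine lowerS hn (by norm_num) (by norm_num) (by positivity) hD ?_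
  rw [Real.rpow_one]
  have h1 : √(2 * Real.pi * Real.exp 1 / n) * √(2 * n / Real.pi) = 2 * √(Real.exp 1) := by
    rw [← Real.sqrt_mul (by positivity)]
    rw [show 2 * Real.pi * Real.exp 1 / n * (2 * n / Real.pi) = 2 ^ 2 * Real.exp 1 by
      field_simp; try norm_num]
    rw [Real.sqrt_mul (by positivity), Real.sqrt_sq (by norm_num)]
  calc _ ≤ (1 + s * a) * √(2 * Real.pi * Real.exp 1 / n) * (D * √(2 * n / Real.pi)) := by
        gcongr
        · exact wn_upper hn
        · exact momEst1 hn
    _ = (1 + s * a) * D * (√(2 * Real.pi * Real.exp 1 / n) * √(2 * n / Real.pi)) := by ring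
    _ = 2 * (D * √(Real.exp 1) * (1 + s * a)) := by rw [h1]; ring
    _ ≤ _ := by linarith

lemma fsec_lower2 {n : ℕ} (hn : 0 < n) {a b s D η : ℝ} (hs : 0 < 1 + s * a) (hsb : 0 < 1 - s * b)
    (hD : 0 < D) (hη : 0 < η) (hwn : η * √(2 * Real.pi * Real.exp 1 / n) ≤ wn n)
    (h : 4 * D * (1 - s * b) ^ 2 ≤ (1 + s * a) ^ 2 * η ^ 2 * (Real.pi * Real.exp 1)) :
    (1 - 1 / D) * ((1 - s * b) ^ n * (2 ^ n * volB 1 n)) ≤ fsec a b n s := by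
  have hw := wn_pos hn
  have hpi := Real.pi_pos
  have hn' : (0:ℝ) < n := by exact_mod_cast hn
  unfold fsec
  rw [volSec' hn a b s hs.le, ← mul_assoc ((1 - s * b) ^ n), ← mul_pow, mul_comm _ (2:ℝ)]
  refine lowerS hn (by norm_num) (by norm_num) (by positivity) hD ?_
  rw [Real.rpow_two, Real.rpow_two]
  have h2 : η ^ 2 * (2 * Real.pi * Real.exp 1 / n) ≤ wn n ^ 2 := by
    have := pow_le_pow_left₀ (by positivity) hwn 2
    rwa [mul_pow, Real.sq_sqrt (by positivity)] at this
  calc _ ≤ (2 * (1 - s * b)) ^ 2 * (D * (2 / n)) := by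
        gcongr
        exact momEst2 hn
    _ = (4 * D * (1 - s * b) ^ 2) * (2 / n) := by ring
    _ ≤ (1 + s * a) ^ 2 * η ^ 2 * (Real.pi * Real.exp 1) * (2 / n) := by gcongr
    _ = (1 + s * a) ^ 2 * (η ^ 2 * (2 * Real.pi * Real.exp 1 / n)) := by ring
    _ ≤ (1 + s * a) ^ 2 * wn n ^ 2 := by gcongr
    _ = _ := by ring

lemma leftLem {a b s0 γ : ℝ} (ha : 0 < a) (hb : 0 < b) (hγ : 0 < γ)
    (hs0 : 1 - s0 * b = √(Real.exp 1) * (1 + s0 * a)) (h : -(1 / a) ≤ s0 - γ) {ε : ℝ} (hε : 0 < ε) :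
    ∃ N : ℕ, ∀ n ≥ N, 0 < n → ∫ s in (-(1/a))..(s0 - γ), fsec a b n s
      ≤ ε * ∫ s in (s0 - γ / 2)..(s0 - γ / 3), fsec a b n s := by
  have hE : 0 < √(Real.exp 1) := Real.sqrt_pos.2 (Real.exp_pos 1)
  have key : ∀ s, -(1 / a) ≤ s → 0 ≤ 1 + s * a := by
    intro s hs
    have := mul_le_mul_of_nonneg_right hs ha.le
    have h2 : -(1 / a) * a = -1 := by field_simp
    linarith
  have h0 : 0 ≤ 1 + (s0 - γ) * a := key _ h
  have hγa : 0 < γ * a := by positivity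
  have hγb : 0 < γ * b := by positivity
  set P := √(Real.exp 1) * (1 + (s0 - γ / 3) * a) with hP
  have hP0 : 0 < P := mul_pos hE (by linarith)
  have hlt : P < 1 - (s0 - γ / 3) * b := by
    have : 0 < √(Real.exp 1) * (γ * a) := by positivity
    have : P = √(Real.exp 1) * (1 + s0 * a) - √(Real.exp 1) * (γ * a) / 3 := by rw [hP]; ring
    linarith
  set D := (1 - (s0 - γ / 3) * b) / P with hD
  have hD1 : 1 < D := by rw [hD, lt_div_iff₀ hP0]; linarith
  have hDP : D * P = 1 - (s0 - γ / 3) * b := by rw [hD]; field_simp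
  refine core (fsec a b) (fun n => if 0 < n then wn n ^ n * volB 2 n else 0) (κ := 1 - 1 / D)
    (q1 := 1 + (s0 - γ) * a) (q2 := 1 + (s0 - γ / 2) * a) ?_ ?_ h ?_ h0 ?_ ?_ ?_ ?_ hε
  · intro n
    split_ifs with hn
    · have := wn_pos hn
      have := volB_nonneg 2 n
      positivity
    · exact le_rfl
  · have : 1 / D < 1 := by rw [div_lt_one (by linarith)]; exact hD1
    linarith
  · linarith
  · linarith
  · intro n hn u v
    exact fsec_int hn a b u v
  · intro n hn s hs
    have hw := wn_pos hn
    have hV := volB_nonneg 2 n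
    rw [if_pos hn]
    refine (fsec_upper1 hn a b s (key s hs.1)).trans ?_
    have := key s hs.1
    have := hs.2
    gcongr
  · refine ⟨0, fun n _ hn s hs => ?_⟩
    have hw := wn_pos hn
    have hV := volB_nonneg 2 n
    rw [if_pos hn]
    have hsa : (s0 - γ / 2) * a ≤ s * a := mul_le_mul_of_nonneg_right hs.1 ha.le
    have hsa' : s * a ≤ (s0 - γ / 3) * a := mul_le_mul_of_nonneg_right hs.2 ha.le
    have hsb' : s * b ≤ (s0 - γ / 3) * b := mul_le_mul_of_nonneg_right hs.2 hb.le
    have hκ : 0 ≤ 1 - 1 / D := by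
      have : 1 / D < 1 := by rw [div_lt_one (by linarith)]; exact hD1
      linarith
    refine le_trans ?_ (fsec_lower1 hn (s := s) (D := D) (by linarith) (by linarith) ?_)
    · have : 0 ≤ 1 + (s0 - γ / 2) * a := by linarith
      gcongr
    · have : D * √(Real.exp 1) * (1 + s * a) ≤ D * P := by
        rw [hP, mul_assoc]; gcongr
      linarith

lemma rightLem {a b s1 γ : ℝ} (ha : 0 < a) (hb : 0 < b) (hγ : 0 < γ) (h1a : 0 < 1 + s1 * a)
    (hs1 : 2 * (1 - s1 * b) = √(Real.pi * Real.exp 1) * (1 + s1 * a))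
    (h : s1 + γ ≤ 1 / b) {ε : ℝ} (hε : 0 < ε) :
    ∃ N : ℕ, ∀ n ≥ N, 0 < n → ∫ s in (s1 + γ)..(1 / b), fsec a b n s
      ≤ ε * ∫ s in (s1 + γ / 3)..(s1 + γ / 2), fsec a b n s := by
  have hpi := Real.pi_pos
  set E := √(Real.pi * Real.exp 1) with hEdef
  have hE : 0 < E := Real.sqrt_pos.2 (by positivity)
  have hE2 : E ^ 2 = Real.pi * Real.exp 1 := Real.sq_sqrt (by positivity)
  have key : ∀ s, s ≤ 1 / b → 0 ≤ 1 - s * b := by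
    intro s hs
    have := mul_le_mul_of_nonneg_right hs hb.le
    have h2 : (1 / b) * b = 1 := by field_simp
    linarith
  have h0 : 0 ≤ 1 - (s1 + γ) * b := key _ h
  have hγa : 0 < γ * a := by positivity
  have hγb : 0 < γ * b := by positivity
  set P := E * (1 + (s1 + γ / 3) * a) with hP
  have hP0 : 0 < P := mul_pos hE (by linarith)
  set Q := 2 * (1 - (s1 + γ / 3) * b) with hQ
  have hQ0 : 0 < Q := by linarith
  have hlt : Q < P := by
    have : 0 < E * (γ * a) := by positivity
    have : P = E * (1 + s1 * a) + E * (γ * a) / 3 := by rw [hP]; ring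
    linarith
  set t := Q / P with ht
  have ht0 : 0 < t := by positivity
  have ht1 : t < 1 := by rw [ht, div_lt_one hP0]; exact hlt
  have htP : t * P = Q := by rw [ht]; field_simp
  have hηt : √t < 1 := by rw [Real.sqrt_lt' one_pos]; simpa using ht1
  obtain ⟨N, hN⟩ := wn_lower (Real.sqrt_pos.2 ht0) hηt
  refine core (fsec a b) (fun n => 2 ^ n * volB 1 n) (κ := 1 - 1 / (1 / t))
    (q1 := 1 - (s1 + γ) * b) (q2 := 1 - (s1 + γ / 2) * b) ?_ ?_ h ?_ h0 ?_ ?_ ?_ ?_ hε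
  · intro n
    have := volB_nonneg 1 n
    positivity
  · rw [one_div_one_div]; linarith
  · linarith
  · linarith
  · intro n hn u v
    exact fsec_int hn a b u v
  · intro n hn s hs
    have hV := volB_nonneg 1 n
    refine (fsec_upper2 hn a b s (key s hs.2)).trans ?_
    have := key s hs.2
    have := hs.1
    gcongr
  · refine ⟨N, fun n hnN hn s hs => ?_⟩
    have hV := volB_nonneg 1 n
    have hsb : s * b ≤ (s1 + γ / 2) * b := mul_le_mul_of_nonneg_right hs.2 hb.le
    have hsb' : (s1 + γ / 3) * b ≤ s * b := mul_le_mul_of_nonneg_right hs.1 hb.le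
    have hsa' : (s1 + γ / 3) * a ≤ s * a := mul_le_mul_of_nonneg_right hs.1 ha.le
    have hκ : 0 ≤ 1 - 1 / (1 / t) := by rw [one_div_one_div]; linarith
    refine le_trans ?_ (fsec_lower2 hn (s := s) (D := 1 / t) (η := √t) (by linarith) (by linarith)
      (by positivity) (Real.sqrt_pos.2 ht0) (hN n hnN hn) ?_)
    · have : 0 ≤ 1 - (s1 + γ / 2) * b := by linarith
      gcongr
    · rw [Real.sq_sqrt ht0.le, ← hE2]
      have e1 : 2 * (1 - s * b) ≤ t * (E * (1 + s * a)) := by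
        have e2 : t * P ≤ t * (E * (1 + s * a)) := by
          rw [hP]; gcongr
        linarith
      have e3 : (2 * (1 - s * b)) ^ 2 ≤ (t * (E * (1 + s * a))) ^ 2 :=
        pow_le_pow_left₀ (by linarith) e1 2
      calc 4 * (1 / t) * (1 - s * b) ^ 2 = (1 / t) * (2 * (1 - s * b)) ^ 2 := by ring
        _ ≤ (1 / t) * (t * (E * (1 + s * a))) ^ 2 := by gcongr
        _ = _ := by field_simp

/-- Volume concentration of `M_n^∘` between the hyperplanes at heights
`s₀ = (1-√e)/(b+a√e)` and `s₁ = (2-√(πe))/(a√(πe)+2b)`. -/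
theorem polarSection_volume_concentration (a b : ℝ) (ha : 0 < a) (hb : 0 < b) :
    ∀ γ > (0 : ℝ), ∃ n₀ : ℕ, ∀ n ≥ n₀,
      ((∫ s in (-(1 / a))..(1 / b), (volume (polarSection a b n s)).toReal) ≤
        (1 + γ) * ∫ s in ((1 - Real.sqrt (Real.exp 1)) /
            (b + a * Real.sqrt (Real.exp 1)) - γ)..((2 - Real.sqrt (Real.pi * Real.exp 1)) /
            (a * Real.sqrt (Real.pi * Real.exp 1) + 2 * b) + γ),
          (volume (polarSection a b n s)).toReal) ∧
      ((∫ s in (-(1 / a))..((1 - Real.sqrt (Real.exp 1)) /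
            (b + a * Real.sqrt (Real.exp 1)) - γ),
          |s| * (volume (polarSection a b n s)).toReal) ≤
        γ * ∫ s in (-(1 / a))..(1 / b), (volume (polarSection a b n s)).toReal) ∧
      ((∫ s in ((2 - Real.sqrt (Real.pi * Real.exp 1)) /
            (a * Real.sqrt (Real.pi * Real.exp 1) + 2 * b) + γ)..(1 / b),
          |s| * (volume (polarSection a b n s)).toReal) ≤
        γ * ∫ s in (-(1 / a))..(1 / b), (volume (polarSection a b n s)).toReal) := by
  have hpi := Real.pi_pos
  set s0 := (1 - √(Real.exp 1)) / (b + a * √(Real.exp 1)) with hs0def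
  set s1 := (2 - √(Real.pi * Real.exp 1)) / (a * √(Real.pi * Real.exp 1) + 2 * b) with hs1def
  have hE0 : 0 < √(Real.exp 1) := Real.sqrt_pos.2 (Real.exp_pos 1)
  have hE1 : 0 < √(Real.pi * Real.exp 1) := Real.sqrt_pos.2 (by positivity)
  have hs0 : 1 - s0 * b = √(Real.exp 1) * (1 + s0 * a) := by
    rw [hs0def]; field_simp; ring
  have hs1 : 2 * (1 - s1 * b) = √(Real.pi * Real.exp 1) * (1 + s1 * a) := by
    rw [hs1def]; field_simp; ring
  have h1a : 0 < 1 + s1 * a := by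
    have : 1 + s1 * a = 2 * (a + b) / (a * √(Real.pi * Real.exp 1) + 2 * b) := by
      rw [hs1def]; field_simp; ring
    rw [this]; positivity
  have h0b : 0 < 1 + s0 * a := by
    have : 1 + s0 * a = (a + b) / (b + a * √(Real.exp 1)) := by
      rw [hs0def]; field_simp; ring
    rw [this]; positivity
  have hEE : √(Real.pi * Real.exp 1) < 2 * √(Real.exp 1) := by
    rw [Real.sqrt_lt' (by positivity), mul_pow, Real.sq_sqrt (Real.exp_pos 1).le]
    have := Real.pi_lt_four
    have := Real.exp_pos 1
    nlinarith
  have hs01 : s0 ≤ s1 := by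
    by_contra hcon
    push Not at hcon
    have e1 : s1 * a ≤ s0 * a := mul_le_mul_of_nonneg_right hcon.le ha.le
    have e2 : s1 * b ≤ s0 * b := mul_le_mul_of_nonneg_right hcon.le hb.le
    have e3 : √(Real.exp 1) * (1 + s1 * a) ≤ √(Real.exp 1) * (1 + s0 * a) := by gcongr
    have e4 : √(Real.pi * Real.exp 1) * (1 + s1 * a) < 2 * √(Real.exp 1) * (1 + s1 * a) := by gcongr
    linarith
  have h0lt : -(1 / a) ≤ s0 := by
    rw [neg_le_iff_add_nonneg]
    have : s0 + 1 / a = (1 + s0 * a) / a := by field_simp; ring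
    rw [this]; positivity
  have h1b : 0 < 1 - s1 * b := by
    have : 0 < √(Real.pi * Real.exp 1) * (1 + s1 * a) := by positivity
    linarith
  have h1lt : s1 ≤ 1 / b := by
    rw [le_div_iff₀ hb]; linarith
  intro γ hγ
  set W := 1 / a + 1 / b with hW
  have hW0 : 0 < W := by positivity
  obtain ⟨ε, hε, hε2, hεW⟩ : ∃ ε > 0, 2 * ε ≤ γ ∧ W * ε ≤ γ := by
    refine ⟨min (γ / 2) (γ / W), by positivity, ?_, ?_⟩
    · have := min_le_left (γ / 2) (γ / W); linarith
    · have := min_le_right (γ / 2) (γ / W)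
      rwa [le_div_iff₀ hW0, mul_comm] at this
  have hM0 : ∀ n, 0 ≤ ∫ s in (s0 - γ)..(s1 + γ), fsec a b n s := fun n =>
    intervalIntegral.integral_nonneg (by linarith) fun s _ => fsec_nonneg a b n s
  have habs : ∀ s, -(1 / a) ≤ s → s ≤ 1 / b → |s| ≤ W := by
    intro s h1 h2
    have : 0 < 1 / a := by positivity
    have : 0 < 1 / b := by positivity
    rw [abs_le]; constructor <;> linarith
  have hwt : ∀ n, 0 < n → ∀ u v, u ≤ v → -(1 / a) ≤ u → v ≤ 1 / b →
      ∫ s in u..v, |s| * fsec a b n s ≤ W * ∫ s in u..v, fsec a b n s := by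
    intro n hn u v huv hu hv
    rw [← intervalIntegral.integral_const_mul]
    apply intervalIntegral.integral_mono_on huv
    · exact (fsec_int hn a b u v).continuousOn_mul (by fun_prop)
    · exact (fsec_int hn a b u v).const_mul W
    · intro s hs
      exact mul_le_mul_of_nonneg_right (habs s (by linarith [hs.1]) (by linarith [hs.2]))
        (fsec_nonneg a b n s)
  have hsub : ∀ n, 0 < n → ∀ u v, u ≤ v → s0 - γ ≤ u → v ≤ s1 + γ →
      ∫ s in u..v, fsec a b n s ≤ ∫ s in (s0 - γ)..(s1 + γ), fsec a b n s := by
    intro n hn u v huv hu hv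
    exact intervalIntegral.integral_mono_interval hu huv hv
      (Filter.Eventually.of_forall fun s => fsec_nonneg a b n s) (fsec_int hn a b _ _)
  have hleft : ∃ N : ℕ, ∀ n ≥ N, 0 < n →
      0 ≤ ∫ s in (-(1/a))..(s0 - γ), fsec a b n s ∧
      ∫ s in (-(1/a))..(s0 - γ), fsec a b n s ≤ ε * ∫ s in (s0 - γ)..(s1 + γ), fsec a b n s ∧
      ∫ s in (-(1/a))..(s0 - γ), |s| * fsec a b n s ≤
        W * ∫ s in (-(1/a))..(s0 - γ), fsec a b n s := by
    by_cases h : -(1 / a) ≤ s0 - γ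
    · obtain ⟨N, hN⟩ := leftLem ha hb hγ hs0 h hε
      refine ⟨N, fun n hn h0 => ⟨?_, ?_, ?_⟩⟩
      · exact intervalIntegral.integral_nonneg h fun s _ => fsec_nonneg a b n s
      · refine (hN n hn h0).trans (mul_le_mul_of_nonneg_left ?_ hε.le)
        exact hsub n h0 _ _ (by linarith) (by linarith) (by linarith)
      · exact hwt n h0 _ _ h le_rfl (by linarith)
    · push Not at h
      refine ⟨0, fun n _ h0 => ?_⟩
      have hz : ∀ s ∈ Set.uIcc (-(1 / a)) (s0 - γ), fsec a b n s = 0 := by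
        intro s hs
        rw [Set.uIcc_of_ge h.le] at hs
        apply fsec_zero h0
        left
        have e := mul_le_mul_of_nonneg_right hs.2 ha.le
        have e2 : -(1 / a) * a = -1 := by field_simp
        linarith
      have e1 : ∫ s in (-(1/a))..(s0 - γ), fsec a b n s = 0 := by
        rw [intervalIntegral.integral_congr (g := fun _ => 0) hz]; simp
      have e2 : ∫ s in (-(1/a))..(s0 - γ), |s| * fsec a b n s = 0 := by
        rw [intervalIntegral.integral_congr (g := fun _ => 0) (fun s hs => by simp [hz s hs])]; simp
      rw [e1, e2]
      exact ⟨le_rfl, mul_nonneg hε.le (hM0 n), by simp⟩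
  have hright : ∃ N : ℕ, ∀ n ≥ N, 0 < n →
      0 ≤ ∫ s in (s1 + γ)..(1 / b), fsec a b n s ∧
      ∫ s in (s1 + γ)..(1 / b), fsec a b n s ≤ ε * ∫ s in (s0 - γ)..(s1 + γ), fsec a b n s ∧
      ∫ s in (s1 + γ)..(1 / b), |s| * fsec a b n s ≤
        W * ∫ s in (s1 + γ)..(1 / b), fsec a b n s := by
    by_cases h : s1 + γ ≤ 1 / b
    · obtain ⟨N, hN⟩ := rightLem ha hb hγ h1a hs1 h hε
      refine ⟨N, fun n hn h0 => ⟨?_, ?_, ?_⟩⟩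
      · exact intervalIntegral.integral_nonneg h fun s _ => fsec_nonneg a b n s
      · refine (hN n hn h0).trans (mul_le_mul_of_nonneg_left ?_ hε.le)
        exact hsub n h0 _ _ (by linarith) (by linarith) (by linarith)
      · exact hwt n h0 _ _ h (by linarith) le_rfl
    · push Not at h
      refine ⟨0, fun n _ h0 => ?_⟩
      have hz : ∀ s ∈ Set.uIcc (s1 + γ) (1 / b), fsec a b n s = 0 := by
        intro s hs
        rw [Set.uIcc_of_ge h.le] at hs
        apply fsec_zero h0
        right
        have e := mul_le_mul_of_nonneg_right hs.1 hb.le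
        have e2 : (1 / b) * b = 1 := by field_simp
        linarith
      have e1 : ∫ s in (s1 + γ)..(1 / b), fsec a b n s = 0 := by
        rw [intervalIntegral.integral_congr (g := fun _ => 0) hz]; simp
      have e2 : ∫ s in (s1 + γ)..(1 / b), |s| * fsec a b n s = 0 := by
        rw [intervalIntegral.integral_congr (g := fun _ => 0) (fun s hs => by simp [hz s hs])]; simp
      rw [e1, e2]
      exact ⟨le_rfl, mul_nonneg hε.le (hM0 n), by simp⟩
  obtain ⟨N1, hN1⟩ := hleft
  obtain ⟨N2, hN2⟩ := hright
  refine ⟨max (max N1 N2) 1, fun n hn => ?_⟩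
  have hn1 : N1 ≤ n := by omega
  have hn2 : N2 ≤ n := by omega
  have h0 : 0 < n := by omega
  obtain ⟨l1, l2, l3⟩ := hN1 n hn1 h0
  obtain ⟨r1, r2, r3⟩ := hN2 n hn2 h0
  have hM := hM0 n
  have hT : ∫ s in (-(1 / a))..(1 / b), fsec a b n s =
      (∫ s in (-(1/a))..(s0 - γ), fsec a b n s) + (∫ s in (s0 - γ)..(s1 + γ), fsec a b n s) +
      ∫ s in (s1 + γ)..(1 / b), fsec a b n s := by
    rw [intervalIntegral.integral_add_adjacent_intervals (fsec_int h0 a b _ _)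
      (fsec_int h0 a b _ _), intervalIntegral.integral_add_adjacent_intervals (fsec_int h0 a b _ _)
      (fsec_int h0 a b _ _)]
  change (∫ s in (-(1 / a))..(1 / b), fsec a b n s ≤
      (1 + γ) * ∫ s in (s0 - γ)..(s1 + γ), fsec a b n s) ∧
    (∫ s in (-(1/a))..(s0 - γ), |s| * fsec a b n s ≤
      γ * ∫ s in (-(1 / a))..(1 / b), fsec a b n s) ∧
    (∫ s in (s1 + γ)..(1 / b), |s| * fsec a b n s ≤
      γ * ∫ s in (-(1 / a))..(1 / b), fsec a b n s)
  rw [hT]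
  set L := ∫ s in (-(1/a))..(s0 - γ), fsec a b n s
  set M := ∫ s in (s0 - γ)..(s1 + γ), fsec a b n s
  set R := ∫ s in (s1 + γ)..(1 / b), fsec a b n s
  have hbig : γ * M ≤ γ * (L + M + R) := mul_le_mul_of_nonneg_left (by linarith) hγ.le
  have hm1 : 2 * ε * M ≤ γ * M := mul_le_mul_of_nonneg_right hε2 hM
  have hm2 : W * ε * M ≤ γ * M := mul_le_mul_of_nonneg_right hεW hM
  have hl : W * L ≤ W * (ε * M) := mul_le_mul_of_nonneg_left l2 hW0.le
  have hr : W * R ≤ W * (ε * M) := mul_le_mul_of_nonneg_left r2 hW0.le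
  refine ⟨by linarith, by linarith, by linarith⟩
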